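/- arXiv:2111.07414 — 2 statements merged into one kernel-verified Lean document; each statement's English description precedes it below -/
import Mathlib

section
/- Let G=(V,A) be a digraph with root r, nonnegative arc costs c̃ and nonnegative penalties π̃, and let Z be a directed cycle avoiding r all of whose arcs have c̃-cost 0. Form Ḡ by contracting Z into a supernode u_Z, giving each arc (u,u_Z) cost min over arcs from u into V(Z) of their c̃-cost, each arc (u_Z,u) cost min over arcs from V(Z) to u of their c̃-cost, penalty π̄_{u_Z} = Σ_{v∈V(Z)} π̃_v, and keeping other costs and penalties. Then O*(Ḡ,c̄,π̄) ≤ O*(G,c̃,π̃). -/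
open Finset

/-- Cost of a walk given by its vertex sequence. -/
def walkCost {V : Type*} (c : V → V → ℝ) (P : List V) : ℝ :=
  ((P.zip P.tail).map fun q => c q.1 q.2).sum

/-- A walk rooted at `r` in the digraph with arc set `A`. -/
def IsWalk {V : Type*} (A : Finset (V × V)) (r : V) (P : List V) : Prop :=
  P.head? = some r ∧ P.Chain' (fun u v => (u, v) ∈ A)

/-- Minimum prize-collecting cost over collections of `r`-rooted walks. -/
noncomputable def pcwOpt {V : Type*} [Fintype V] [DecidableEq V]
    (A : Finset (V × V)) (c : V → V → ℝ) (π : V → ℝ) (r : V) : ℝ :=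
  sInf {z : ℝ | ∃ C : List (List V), (∀ P ∈ C, IsWalk A r P) ∧
    z = (C.map (walkCost c)).sum +
      ∑ v ∈ Finset.univ.filter (fun v => ∀ P ∈ C, v ∉ P), π v}

section Walks

variable {V W : Type*}

theorem walkCost_cons_cons (c : V → V → ℝ) (a b : V) (l : List V) :
    walkCost c (a :: b :: l) = c a b + walkCost c (b :: l) := by
  simp [walkCost]

theorem walkCost_nonneg {A : Finset (V × V)} {c : V → V → ℝ}
    (hc : ∀ u w, (u, w) ∈ A → 0 ≤ c u w) {P : List V}
    (hP : P.IsChain fun u v => (u, v) ∈ A) : 0 ≤ walkCost c P := by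
  induction hP with
  | nil => simp [walkCost]
  | singleton a => simp [walkCost]
  | cons_cons hab _ ih =>
    rw [walkCost_cons_cons]
    exact add_nonneg (hc _ _ hab) ih

/-- If `f` sends every arc to an arc that is no more expensive, or collapses it, then every walk
has an image walk that is no more expensive and visits the images of all its nodes. -/
theorem IsWalk.exists_image {A : Finset (V × V)} {B : Finset (W × W)}
    {c : V → V → ℝ} {d : W → W → ℝ} {f : V → W} (hc : ∀ u w, 0 ≤ c u w)
    (hf : ∀ a b, (a, b) ∈ A → f a = f b ∨ ((f a, f b) ∈ B ∧ d (f a) (f b) ≤ c a b))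
    {r : V} {P : List V} (hP : IsWalk A r P) :
    ∃ Q, IsWalk B (f r) Q ∧ walkCost d Q ≤ walkCost c P ∧ ∀ v ∈ P, f v ∈ Q := by
  induction P generalizing r with
  | nil => simp [IsWalk] at hP
  | cons a l ih =>
    obtain ⟨hr, hchain⟩ := hP
    obtain rfl : a = r := by simpa using hr
    cases l with
    | nil =>
      exact ⟨[f a], ⟨rfl, List.isChain_singleton _⟩, by simp [walkCost], by simp⟩
    | cons b l =>
      obtain ⟨hab, hbl⟩ := List.isChain_cons_cons.1 hchain
      obtain ⟨Q, ⟨hQr, hQ⟩, hcost, hmem⟩ := ih (r := b) ⟨rfl, hbl⟩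
      cases Q with
      | nil => simp at hQr
      | cons q l' =>
        obtain rfl : q = f b := by simpa using hQr
        rw [walkCost_cons_cons]
        rcases hf a b hab with h | ⟨h, hle⟩
        · refine ⟨f b :: l', ⟨by rw [h]; rfl, hQ⟩, by linarith [hc a b], fun v hv => ?_⟩
          rcases List.mem_cons.1 hv with rfl | hv
          · simp [h]
          · exact hmem v hv
        · refine ⟨f a :: f b :: l', ⟨rfl, List.isChain_cons_cons.2 ⟨h, hQ⟩⟩, ?_, fun v hv => ?_⟩
          · rw [walkCost_cons_cons]
            linarith
          · rcases List.mem_cons.1 hv with rfl | hv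
            · simp
            · exact List.mem_cons_of_mem _ (hmem v hv)

end Walks

/-- Concentrating the weight of `Z` at `u` does not increase the total weight when passing
from `S` to a set `T` that lies in `S` outside `Z` and contains `u` only if `Z ⊆ S`. -/
theorem sum_concentrated_le {V : Type*} [DecidableEq V] {S T Z : Finset V} {u : V}
    {π ρ : V → ℝ} (hπ : ∀ v, 0 ≤ π v) (hu : ρ u = ∑ z ∈ Z, π z)
    (hout : ∀ v, v ∉ Z → ρ v = π v) (hin : ∀ v ∈ Z, v ≠ u → ρ v = 0)
    (hT : ∀ v ∈ T, v ∉ Z → v ∈ S) (huT : u ∈ T → Z ⊆ S) :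
    ∑ v ∈ T, ρ v ≤ ∑ v ∈ S, π v := by
  rw [← Finset.sum_filter_add_sum_filter_not T (· ∈ Z),
    ← Finset.sum_filter_add_sum_filter_not S (· ∈ Z)]
  refine add_le_add ?_ ?_
  · by_cases h : u ∈ T
    · have hZS : S.filter (· ∈ Z) = Z := by
        ext v
        simpa using fun hv => huT h hv
      rw [hZS, ← hu]
      by_cases huZ : u ∈ Z
      · exact (Finset.sum_eq_single_of_mem u (by simp [h, huZ])
          fun v hv hvu => hin v (Finset.mem_filter.1 hv).2 hvu).le
      · rw [hu, Finset.sum_eq_zero]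
        · exact Finset.sum_nonneg fun v _ => hπ v
        · intro v hv
          have hvZ := (Finset.mem_filter.1 hv).2
          exact hin v hvZ fun hvu => huZ (hvu ▸ hvZ)
    · rw [Finset.sum_eq_zero]
      · exact Finset.sum_nonneg fun v _ => hπ v
      · intro v hv
        obtain ⟨hvT, hvZ⟩ := Finset.mem_filter.1 hv
        exact hin v hvZ fun hvu => h (hvu ▸ hvT)
  · rw [Finset.sum_congr rfl fun v hv => hout v (Finset.mem_filter.1 hv).2]
    refine Finset.sum_le_sum_of_subset_of_nonneg (fun v hv => ?_) fun v _ _ => hπ v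
    obtain ⟨hvT, hvZ⟩ := Finset.mem_filter.1 hv
    exact Finset.mem_filter.2 ⟨hT v hvT hvZ, hvZ⟩

/-- Contracting a zero-cost directed cycle `Z` (avoiding `r`,
given by the vertex list `L`) into the supernode `uZ` — with incoming/outgoing arc
costs taken as minima over the corresponding arcs of `G`, the penalty of `uZ` being
the total penalty of `Z`, and other costs/penalties kept — does not increase the
optimal prize-collecting walks value.  (Nodes of `Z` other than `uZ` are deleted:
they are isolated in `Abar` and their penalty is set to `0`.) -/
theorem pcwOpt_contract_cycle
    {V : Type*} [Fintype V] [DecidableEq V]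
    (A Abar : Finset (V × V)) (r uZ : V) (Z : Finset V)
    (c cbar : V → V → ℝ) (π πbar : V → ℝ) (L : List V)
    (hc : ∀ u w, 0 ≤ c u w) (hπ : ∀ u, 0 ≤ π u)
    (hrZ : r ∉ Z) (huZ : uZ ∈ Z)
    (hLne : L ≠ []) (hLnd : L.Nodup) (hLZ : L.toFinset = Z)
    (hLarc : ∀ q ∈ L.zip (L.rotate 1), (q.1, q.2) ∈ A ∧ c q.1 q.2 = 0)
    (hAbar : ∀ u w : V, (u, w) ∈ Abar ↔
      (u ∉ Z ∧ w ∉ Z ∧ (u, w) ∈ A) ∨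
      (u ∉ Z ∧ w = uZ ∧ ∃ z ∈ Z, (u, z) ∈ A) ∨
      (u = uZ ∧ w ∉ Z ∧ ∃ z ∈ Z, (z, w) ∈ A))
    (hcbar1 : ∀ u w, u ∉ Z → w ∉ Z → cbar u w = c u w)
    (hcbar2 : ∀ u, u ∉ Z → ∀ h : (Z.filter fun z => (u, z) ∈ A).Nonempty,
      cbar u uZ = (Z.filter fun z => (u, z) ∈ A).inf' h fun z => c u z)
    (hcbar3 : ∀ w, w ∉ Z → ∀ h : (Z.filter fun z => (z, w) ∈ A).Nonempty,
      cbar uZ w = (Z.filter fun z => (z, w) ∈ A).inf' h fun z => c z w)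
    (hπbar1 : πbar uZ = ∑ z ∈ Z, π z)
    (hπbar2 : ∀ u, u ∉ Z → πbar u = π u)
    (hπbar3 : ∀ u ∈ Z, u ≠ uZ → πbar u = 0) :
    pcwOpt Abar cbar πbar r ≤ pcwOpt A c π r := by
  have hπbar : ∀ v, 0 ≤ πbar v := by
    intro v
    by_cases hv : v ∈ Z
    · by_cases hvu : v = uZ
      · rw [hvu, hπbar1]
        exact Finset.sum_nonneg fun z _ => hπ z
      · exact (hπbar3 v hv hvu).ge
    · rw [hπbar2 v hv]
      exact hπ v
  have hcbar : ∀ u w, (u, w) ∈ Abar → 0 ≤ cbar u w := by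
    intro u w huw
    rcases (hAbar u w).1 huw with ⟨hu, hw, -⟩ | ⟨hu, rfl, z, hz, hA⟩ | ⟨rfl, hw, z, hz, hA⟩
    · rw [hcbar1 u w hu hw]
      exact hc u w
    · rw [hcbar2 u hu ⟨z, by simp [hz, hA]⟩]
      exact Finset.le_inf' _ _ fun z _ => hc u z
    · rw [hcbar3 w hw ⟨z, by simp [hz, hA]⟩]
      exact Finset.le_inf' _ _ fun z _ => hc z w
  let f : V → V := fun v => if v ∈ Z then uZ else v
  have hfin : ∀ v, v ∈ Z → f v = uZ := fun v hv => if_pos hv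
  have hfout : ∀ v, v ∉ Z → f v = v := fun v hv => if_neg hv
  have hf : ∀ a b, (a, b) ∈ A →
      f a = f b ∨ ((f a, f b) ∈ Abar ∧ cbar (f a) (f b) ≤ c a b) := by
    intro a b hab
    rw [hAbar]
    by_cases ha : a ∈ Z <;> by_cases hb : b ∈ Z
    · exact .inl ((hfin a ha).trans (hfin b hb).symm)
    · rw [hfin a ha, hfout b hb]
      have hmem : a ∈ Z.filter fun z => (z, b) ∈ A := by simp [ha, hab]
      refine .inr ⟨.inr (.inr ⟨rfl, hb, a, ha, hab⟩), ?_⟩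
      rw [hcbar3 b hb ⟨a, hmem⟩]
      exact Finset.inf'_le (fun z => c z b) hmem
    · rw [hfout a ha, hfin b hb]
      have hmem : b ∈ Z.filter fun z => (a, z) ∈ A := by simp [hb, hab]
      refine .inr ⟨.inr (.inl ⟨ha, rfl, b, hb, hab⟩), ?_⟩
      rw [hcbar2 a ha ⟨b, hmem⟩]
      exact Finset.inf'_le (fun z => c a z) hmem
    · rw [hfout a ha, hfout b hb]
      exact .inr ⟨.inl ⟨ha, hb, hab⟩, (hcbar1 a b ha hb).le⟩
  have himage : ∀ P, ∃ Q, IsWalk A r P →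
      IsWalk Abar r Q ∧ walkCost cbar Q ≤ walkCost c P ∧ ∀ v ∈ P, f v ∈ Q := by
    intro P
    by_cases hP : IsWalk A r P
    · obtain ⟨Q, hQ⟩ := hP.exists_image hc hf
      rw [hfout r hrZ] at hQ
      exact ⟨Q, fun _ => hQ⟩
    · exact ⟨[], fun h => absurd h hP⟩
  choose g hg using himage
  refine le_csInf ⟨_, [], by simp, rfl⟩ ?_
  rintro _ ⟨C, hC, rfl⟩
  rw [pcwOpt]
  refine le_trans (csInf_le ⟨0, ?_⟩ ⟨C.map g, ?_, rfl⟩) (add_le_add ?_ ?_)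
  · rintro _ ⟨D, hD, rfl⟩
    refine add_nonneg (List.sum_nonneg ?_) (Finset.sum_nonneg fun v _ => hπbar v)
    intro x hx
    obtain ⟨Q, hQ, rfl⟩ := List.mem_map.1 hx
    exact walkCost_nonneg hcbar (hD Q hQ).2
  · intro Q hQ
    obtain ⟨P, hP, rfl⟩ := List.mem_map.1 hQ
    exact (hg P (hC P hP)).1
  · rw [List.map_map]
    exact List.sum_le_sum fun P hP => (hg P (hC P hP)).2.1
  · have hvisit : ∀ v, (∀ Q ∈ C.map g, f v ∉ Q) → ∀ P ∈ C, v ∉ P := fun v hv P hP hvP =>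
      hv (g P) (List.mem_map_of_mem hP) ((hg P (hC P hP)).2.2 v hvP)
    refine sum_concentrated_le hπ hπbar1 hπbar2 hπbar3 ?_ ?_
    · intro v hv hvZ
      refine Finset.mem_filter.2 ⟨Finset.mem_univ v, hvisit v ?_⟩
      rw [hfout v hvZ]
      exact (Finset.mem_filter.1 hv).2
    · intro hu v hvZ
      refine Finset.mem_filter.2 ⟨Finset.mem_univ v, hvisit v ?_⟩
      rw [hfin v hvZ]
      exact (Finset.mem_filter.1 hu).2
end

section
/- Let G=(V,A), c ≥ 0, π ≥ 0, root r. Then the minimum prize-collecting cost over out-arborescences rooted at r is at most the optimum value of the prize-collecting walks LP: min over out-arborescences T of [c(T)+π(V∖V(T))] ≤ min over feasible (x,p) of [Σ_a c_a x_a + Σ_v π_v p_v], where feasibility means x(δ^in(S))+p_v ≥ 1 for all S ⊆ V∖{r}, v ∈ S, x(δ^in(v)) ≥ x(δ^out(v)) for v ≠ r, and x,p ≥ 0. -/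
open Finset

/-- Feasibility for the prize-collecting walks LP. -/
def LPfeas {V : Type*} [Fintype V] [DecidableEq V]
    (A : Finset (V × V)) (r : V) (x : V → V → ℝ) (p : V → ℝ) : Prop :=
  (∀ u w, 0 ≤ x u w) ∧ (∀ u, 0 ≤ p u) ∧
  (∀ u w, (u, w) ∉ A → x u w = 0) ∧
  (∀ S : Finset V, r ∉ S → ∀ v ∈ S, 1 ≤ (∑ u ∈ Sᶜ, ∑ w ∈ S, x u w) + p v) ∧
  (∀ v, v ≠ r → (∑ u, x v u) ≤ ∑ u, x u v)

/-- Optimal value of the prize-collecting walks LP. -/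
noncomputable def lpOpt {V : Type*} [Fintype V] [DecidableEq V]
    (A : Finset (V × V)) (c : V → V → ℝ) (π : V → ℝ) (r : V) : ℝ :=
  sInf {z : ℝ | ∃ x p, LPfeas A r x p ∧
    z = (∑ u, ∑ w, c u w * x u w) + ∑ u, π u * p u}

namespace PrizeCollecting

universe u

section Cuts

variable {V : Type*} [Fintype V]

open Classical in
/-- The total weight `x(δ^in(S))` of the arcs entering `S`. -/
noncomputable def cut (x : V → V → ℝ) (S : Set V) : ℝ :=
  ∑ a, ∑ b, if a ∉ S ∧ b ∈ S then x a b else 0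

lemma sum_sum_single (x : V → V → ℝ) (a₀ b₀ : V) [DecidableEq V] :
    (∑ a, ∑ b, if a = a₀ ∧ b = b₀ then x a b else 0) = x a₀ b₀ := by
  simp [ite_and]

lemma cut_inter_add_cut_union {x : V → V → ℝ} (hx : ∀ a b, 0 ≤ x a b) {S T : Set V} {a₀ b₀ : V}
    (ha : a₀ ∈ S \ T) (hb : b₀ ∈ T \ S) :
    cut x (S ∩ T) + cut x (S ∪ T) + x a₀ b₀ ≤ cut x S + cut x T := by
  classical
  rw [← sum_sum_single x a₀ b₀]
  simp only [cut, ← sum_add_distrib]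
  refine sum_le_sum fun a _ => sum_le_sum fun b _ => ?_
  have := hx a b
  simp only [Set.mem_sdiff, Set.mem_inter_iff, Set.mem_union] at *
  by_cases a ∈ S <;> by_cases a ∈ T <;> by_cases b ∈ S <;> by_cases b ∈ T <;> grind

lemma cut_inter_add_cut_union_le {x : V → V → ℝ} (hx : ∀ a b, 0 ≤ x a b) (S T : Set V) :
    cut x (S ∩ T) + cut x (S ∪ T) ≤ cut x S + cut x T := by
  classical
  simp only [cut, ← sum_add_distrib]
  refine sum_le_sum fun a _ => sum_le_sum fun b _ => ?_
  have := hx a b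
  simp only [Set.mem_inter_iff, Set.mem_union]
  by_cases a ∈ S <;> by_cases a ∈ T <;> by_cases b ∈ S <;> by_cases b ∈ T <;> grind

lemma preflow_set {x : V → V → ℝ} {r : V} (hflow : ∀ v, v ≠ r → ∑ u, x v u ≤ ∑ u, x u v)
    {I : Set V} (hr : r ∉ I) [DecidablePred (· ∈ I)] :
    (∑ a, ∑ b, if a ∈ I then x a b else 0) ≤ ∑ a, ∑ b, if b ∈ I then x a b else 0 := by
  rw [sum_comm (f := fun a b => if b ∈ I then x a b else 0)]
  refine sum_le_sum fun a _ => ?_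
  by_cases ha : a ∈ I
  · simpa [ha] using hflow a (fun h => hr (h ▸ ha))
  · simp [ha]

lemma cut_sdiff_add_cut_sdiff {x : V → V → ℝ} (hx : ∀ a b, 0 ≤ x a b) {r : V}
    (hflow : ∀ v, v ≠ r → ∑ u, x v u ≤ ∑ u, x u v) {S T : Set V} (hr : r ∉ S ∩ T) {a₀ b₀ : V}
    (h : a₀ ∈ S ∩ T ∧ b₀ ∉ S ∪ T ∨ b₀ ∈ S ∩ T ∧ a₀ ∉ S ∪ T) :
    cut x (S \ T) + cut x (T \ S) + x a₀ b₀ ≤ cut x S + cut x T := by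
  classical
  have hI := preflow_set hflow hr
  suffices cut x (S \ T) + cut x (T \ S) + x a₀ b₀ +
      (∑ a, ∑ b, if b ∈ S ∩ T then x a b else 0) ≤
      cut x S + cut x T + ∑ a, ∑ b, if a ∈ S ∩ T then x a b else 0 by linarith
  rw [← sum_sum_single x a₀ b₀]
  simp only [cut, ← sum_add_distrib]
  refine sum_le_sum fun a _ => sum_le_sum fun b _ => ?_
  have := hx a b
  simp only [Set.mem_sdiff, Set.mem_inter_iff, Set.mem_union] at *
  by_cases a ∈ S <;> by_cases a ∈ T <;> by_cases b ∈ S <;> by_cases b ∈ T <;> grind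

lemma cut_sdiff_add_cut_sdiff_le {x : V → V → ℝ} (hx : ∀ a b, 0 ≤ x a b) {r : V}
    (hflow : ∀ v, v ≠ r → ∑ u, x v u ≤ ∑ u, x u v) {S T : Set V} (hr : r ∉ S ∩ T) :
    cut x (S \ T) + cut x (T \ S) ≤ cut x S + cut x T := by
  classical
  have hI := preflow_set hflow hr
  suffices cut x (S \ T) + cut x (T \ S) +
      (∑ a, ∑ b, if b ∈ S ∩ T then x a b else 0) ≤
      cut x S + cut x T + ∑ a, ∑ b, if a ∈ S ∩ T then x a b else 0 by linarith
  simp only [cut, ← sum_add_distrib]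
  refine sum_le_sum fun a _ => sum_le_sum fun b _ => ?_
  have := hx a b
  simp only [Set.mem_sdiff, Set.mem_inter_iff]
  by_cases a ∈ S <;> by_cases a ∈ T <;> by_cases b ∈ S <;> by_cases b ∈ T <;> grind

/-- `S` attains equality in a cut constraint of some vertex other than `v`. -/
def IsTight (r v : V) (x : V → V → ℝ) (q : V → ℝ) (S : Set V) : Prop :=
  r ∉ S ∧ ∃ t ∈ S, t ≠ v ∧ cut x S = q t

lemma IsTight.uncross {r v : V} {x : V → V → ℝ} {q : V → ℝ} (hx : ∀ a b, 0 ≤ x a b)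
    (hcut : ∀ S : Set V, r ∉ S → ∀ t ∈ S, t ≠ v → q t ≤ cut x S)
    (hflow : ∀ v, v ≠ r → ∑ u, x v u ≤ ∑ u, x u v) {S T : Set V}
    (hS : IsTight r v x q S) (hT : IsTight r v x q T) :
    (IsTight r v x q (S ∩ T) ∧ IsTight r v x q (S ∪ T) ∧
      ∀ a ∈ S \ T, ∀ b ∈ T \ S, x a b = 0) ∨
    (IsTight r v x q (S \ T) ∧ IsTight r v x q (T \ S) ∧
      ∀ a b, (a ∈ S ∩ T ∧ b ∉ S ∪ T ∨ b ∈ S ∩ T ∧ a ∉ S ∪ T) → x a b = 0) := by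
  obtain ⟨hrS, s, hs, hsv, hSs⟩ := hS
  obtain ⟨hrT, t, ht, htv, hTt⟩ := hT
  have hrI : r ∉ S ∩ T := fun h => hrS h.1
  have hrU : r ∉ S ∪ T := fun h => h.elim hrS hrT
  have hrP : r ∉ S \ T := fun h => hrS h.1
  have hrQ : r ∉ T \ S := fun h => hrT h.1
  have hle := cut_inter_add_cut_union_le hx S T
  by_cases hsT : s ∈ T
  · left
    have h₁ := hcut _ hrI s ⟨hs, hsT⟩ hsv
    have h₂ := hcut _ hrU t (Or.inr ht) htv
    refine ⟨⟨hrI, s, ⟨hs, hsT⟩, hsv, by linarith⟩, ⟨hrU, t, Or.inr ht, htv, by linarith⟩, ?_⟩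
    intro a ha b hb
    have := cut_inter_add_cut_union hx ha hb
    exact le_antisymm (by linarith) (hx a b)
  by_cases htS : t ∈ S
  · left
    have h₁ := hcut _ hrI t ⟨htS, ht⟩ htv
    have h₂ := hcut _ hrU s (Or.inl hs) hsv
    refine ⟨⟨hrI, t, ⟨htS, ht⟩, htv, by linarith⟩, ⟨hrU, s, Or.inl hs, hsv, by linarith⟩, ?_⟩
    intro a ha b hb
    have := cut_inter_add_cut_union hx ha hb
    exact le_antisymm (by linarith) (hx a b)
  · right
    have hle' := cut_sdiff_add_cut_sdiff_le hx hflow hrI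
    have h₁ := hcut _ hrP s ⟨hs, hsT⟩ hsv
    have h₂ := hcut _ hrQ t ⟨ht, htS⟩ htv
    refine ⟨⟨hrP, s, ⟨hs, hsT⟩, hsv, by linarith⟩, ⟨hrQ, t, ⟨ht, htS⟩, htv, by linarith⟩, ?_⟩
    intro a b hab
    have := cut_sdiff_add_cut_sdiff hx hflow hrI hab
    exact le_antisymm (by linarith) (hx a b)

lemma cut_sdiff_singleton_lt {x : V → V → ℝ} (hx : ∀ a b, 0 ≤ x a b) {v w : V} {M : Set V}
    (hv : v ∈ M) (hw : w ∉ M) (hvw : 0 < x v w) (hflow : ∑ u, x v u ≤ ∑ u, x u v)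
    (hin : ∀ u ∈ M, u ≠ v → x u v = 0) : cut x (M \ {v}) < cut x M := by
  classical
  suffices cut x (M \ {v}) + x v w + (∑ u, x u v) ≤ cut x M + ∑ u, x v u by linarith
  have h₁ : ∑ u, x u v = ∑ a, ∑ b, if b = v then x a b else 0 := by simp
  have h₂ : ∑ u, x v u = ∑ a, ∑ b, if a = v then x a b else 0 := by
    rw [sum_comm]; simp
  rw [h₁, h₂, ← sum_sum_single x v w]
  simp only [cut, ← sum_add_distrib]
  refine sum_le_sum fun a _ => sum_le_sum fun b _ => ?_
  have := hx a b
  have := hin a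
  simp only [Set.mem_sdiff, Set.mem_singleton_iff]
  by_cases a ∈ M <;> by_cases b ∈ M <;> by_cases a = v <;> by_cases b = v <;> grind

lemma cut_insert_lt {x : V → V → ℝ} (hx : ∀ a b, 0 ≤ x a b) {v w : V} {N : Set V}
    (hv : v ∉ N) (hw : w ∈ N) (hvw : 0 < x v w)
    (hin : ∀ u ∉ N, u ≠ v → x u v = 0) : cut x (insert v N) < cut x N := by
  classical
  suffices cut x (insert v N) + x v w ≤ cut x N by linarith
  rw [← sum_sum_single x v w]
  simp only [cut, ← sum_add_distrib]
  refine sum_le_sum fun a _ => sum_le_sum fun b _ => ?_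
  have := hx a b
  have := hin a
  simp only [Set.mem_insert_iff]
  by_cases a ∈ N <;> by_cases b ∈ N <;> by_cases a = v <;> by_cases b = v <;> grind

/-- Every arc leaving a preflow vertex can be paired with an entering arc that no tight set
prevents from being split off. -/
lemma exists_splittable {r v w : V} {x : V → V → ℝ} {q : V → ℝ} (hx : ∀ a b, 0 ≤ x a b)
    (hcut : ∀ S : Set V, r ∉ S → ∀ t ∈ S, t ≠ v → q t ≤ cut x S)
    (hflow : ∀ v, v ≠ r → ∑ u, x v u ≤ ∑ u, x u v) (hvr : v ≠ r) (hwv : w ≠ v)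
    (hvw : 0 < x v w) :
    ∃ u, u ≠ v ∧ 0 < x u v ∧ ∀ S, IsTight r v x q S →
      ¬ (v ∈ S ∧ u ∉ S ∧ w ∉ S) ∧ ¬ (v ∉ S ∧ u ∈ S ∧ w ∈ S) := by
  by_contra! hcon
  have hcon' : ∀ u, u ≠ v → x u v ≠ 0 → ∃ S, IsTight r v x q S ∧
      (v ∈ S ∧ u ∉ S ∧ w ∉ S ∨ v ∉ S ∧ u ∈ S ∧ w ∈ S) := by
    intro u huv hu
    obtain ⟨S, hS, h⟩ := hcon u huv (lt_of_le_of_ne (hx u v) hu.symm)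
    exact ⟨S, hS, by tauto⟩
  have noM : ∀ M, IsTight r v x q M → v ∈ M → w ∉ M → ¬ ∀ u ∈ M, u ≠ v → x u v = 0 := by
    rintro M ⟨hr, t, ht, htv, hMt⟩ hv hw hin
    have h₁ := cut_sdiff_singleton_lt hx hv hw hvw (hflow v hvr) hin
    have h₂ := hcut (M \ {v}) (fun h => hr h.1) t ⟨ht, htv⟩ htv
    linarith
  have noN : ∀ N, IsTight r v x q N → v ∉ N → w ∈ N → ¬ ∀ u ∉ N, u ≠ v → x u v = 0 := by
    rintro N ⟨hr, t, ht, htv, hNt⟩ hv hw hin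
    have h₁ := cut_insert_lt hx hv hw hvw hin
    have h₂ := hcut (insert v N) (by simp [hr, hvr.symm]) t (Or.inr ht) htv
    linarith
  have hAmin : ∀ M, Minimal (fun S => IsTight r v x q S ∧ v ∈ S ∧ w ∉ S) M →
      ∀ T, IsTight r v x q T → v ∈ T → w ∉ T → M ⊆ T := by
    intro M hM T hT hvT hwT
    obtain ⟨hMt, hvM, hwM⟩ := hM.prop
    rcases hMt.uncross hx hcut hflow hT with ⟨hI, -, -⟩ | ⟨-, -, h⟩
    · exact fun a ha => (hM.2 (y := M ∩ T) ⟨hI, ⟨hvM, hvT⟩, fun h => hwM h.1⟩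
        (fun a ha => ha.1) ha).2
    · have := h v w (Or.inl ⟨⟨hvM, hvT⟩, fun h => h.elim hwM hwT⟩)
      linarith
  have hBmax : ∀ N, Maximal (fun S => IsTight r v x q S ∧ v ∉ S ∧ w ∈ S) N →
      ∀ T, IsTight r v x q T → v ∉ T → w ∈ T → T ⊆ N := by
    intro N hN T hT hvT hwT
    obtain ⟨hNt, hvN, hwN⟩ := hN.prop
    rcases hNt.uncross hx hcut hflow hT with ⟨-, hU, -⟩ | ⟨-, -, h⟩
    · exact fun a ha => hN.2 (y := N ∪ T) ⟨hU, fun h => h.elim hvN hvT, Or.inl hwN⟩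
        (fun a ha => Or.inl ha) (Or.inr ha)
    · have := h v w (Or.inr ⟨⟨hwN, hwT⟩, fun h => h.elim hvN hvT⟩)
      linarith
  by_cases hA : ∃ S, IsTight r v x q S ∧ v ∈ S ∧ w ∉ S
  · obtain ⟨M, hM⟩ := (Set.toFinite {S | IsTight r v x q S ∧ v ∈ S ∧ w ∉ S}).exists_minimal hA
    obtain ⟨hMt, hvM, hwM⟩ := hM.prop
    refine noM M hMt hvM hwM fun u huM huv => ?_
    by_contra hu
    obtain ⟨N, hNt, ⟨hvN, huN, hwN⟩ | ⟨hvN, huN, hwN⟩⟩ := hcon' u huv hu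
    · exact huN (hAmin M hM N hNt hvN hwN huM)
    rcases hMt.uncross hx hcut hflow hNt with ⟨-, -, h⟩ | ⟨hP, -, -⟩
    · have := h v ⟨hvM, hvN⟩ w ⟨hwN, hwM⟩
      linarith
    · exact (hAmin M hM _ hP ⟨hvM, hvN⟩ (fun h => hwM h.1) huM).2 huN
  · have hB : ∃ S, IsTight r v x q S ∧ v ∉ S ∧ w ∈ S := by
      by_contra hB
      have hin : ∀ u, u ≠ v → x u v = 0 := by
        intro u huv
        by_contra hu
        obtain ⟨S, hS, ⟨h₁, -, h₂⟩ | ⟨h₁, -, h₂⟩⟩ := hcon' u huv hu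
        exacts [hA ⟨S, hS, h₁, h₂⟩, hB ⟨S, hS, h₁, h₂⟩]
      have h₁ := hflow v hvr
      classical
      rw [Fintype.sum_eq_add_sum_subtype_ne _ v, Fintype.sum_eq_add_sum_subtype_ne _ v,
        sum_eq_zero (s := univ) (f := fun i : {i // i ≠ v} => x i v) (fun i _ => hin i i.2)] at h₁
      have h₂ := single_le_sum (f := fun i : {i // i ≠ v} => x v i) (fun i _ => hx v i)
        (mem_univ ⟨w, hwv⟩)
      simp only at h₂
      linarith
    obtain ⟨N, hN⟩ := (Set.toFinite {S | IsTight r v x q S ∧ v ∉ S ∧ w ∈ S}).exists_maximal hB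
    obtain ⟨hNt, hvN, hwN⟩ := hN.prop
    refine noN N hNt hvN hwN fun u huN huv => ?_
    by_contra hu
    obtain ⟨S, hS, ⟨h₁, -, h₂⟩ | ⟨h₁, h₃, h₂⟩⟩ := hcon' u huv hu
    exacts [hA ⟨S, hS, h₁, h₂⟩, huN (hBmax N hN S hS h₁ h₂ h₃)]

end Cuts

section Splitting

variable {V : Type*} [Fintype V]

lemma cut_add_smul (x e : V → V → ℝ) (ε : ℝ) (S : Set V) :
    cut (fun a b => x a b + ε * e a b) S = cut x S + ε * cut e S := by
  simp only [cut, mul_sum, ← sum_add_distrib]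
  refine sum_congr rfl fun a _ => sum_congr rfl fun b _ => ?_
  split_ifs <;> simp

open Classical in
/-- The direction that replaces the arcs `(u, v)` and `(v, w)` by the arc `(u, w)`. -/
noncomputable def splitDir (u v w : V) (a b : V) : ℝ :=
  (if a = u ∧ b = w then 1 else 0) - (if a = u ∧ b = v then 1 else 0) -
    (if a = v ∧ b = w then 1 else 0)

lemma sum_mul_splitDir (c : V → V → ℝ) (u v w : V) :
    ∑ a, ∑ b, c a b * splitDir u v w a b = c u w - c u v - c v w := by
  classical
  simp [splitDir, mul_sub, sum_sub_distrib, ite_and]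

lemma sum_splitDir_out (u v w a : V) :
    ∑ b, splitDir u v w a b = ∑ b, splitDir u v w b a := by
  classical
  simp only [splitDir, sum_sub_distrib, ite_and]
  simp

lemma cut_splitDir_nonneg {u v w : V} {S : Set V} (h₁ : ¬ (v ∈ S ∧ u ∉ S ∧ w ∉ S))
    (h₂ : ¬ (v ∉ S ∧ u ∈ S ∧ w ∈ S)) : 0 ≤ cut (splitDir u v w) S := by
  classical
  have := sum_mul_splitDir (fun a b => if a ∉ S ∧ b ∈ S then 1 else 0) u v w
  simp only [ite_mul, one_mul, zero_mul] at this
  rw [cut, this]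
  split_ifs <;> norm_num <;> grind

lemma eventually_nonneg_add_mul {α β : ℝ} (h : 0 < α ∨ 0 ≤ α ∧ 0 ≤ β) :
    ∀ᶠ ε in nhdsWithin (0 : ℝ) (Set.Ioi 0), 0 ≤ α + ε * β := by
  rcases h with h | ⟨h, h'⟩
  · have : Filter.Tendsto (fun ε : ℝ => α + ε * β) (nhds 0) (nhds (α + 0 * β)) :=
      Continuous.tendsto (by fun_prop) 0
    rw [zero_mul, add_zero] at this
    filter_upwards [(this.eventually (lt_mem_nhds h)).filter_mono nhdsWithin_le_nhds] with ε hε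
    exact hε.le
  · filter_upwards [self_mem_nhdsWithin] with ε hε
    exact add_nonneg h (mul_nonneg (le_of_lt hε) h')

/-- All arcs leaving a preflow vertex `v` can be split off: the cut requirements of the
other vertices survive, and the cost does not increase as long as `c` satisfies the triangle
inequality through `v`. -/
lemma exists_split_off {r v : V} {x₀ : V → V → ℝ} {q : V → ℝ} {c : V → V → ℝ}
    (hx₀ : ∀ a b, 0 ≤ x₀ a b)
    (hcut₀ : ∀ S : Set V, r ∉ S → ∀ t ∈ S, t ≠ v → q t ≤ cut x₀ S)
    (hflow₀ : ∀ v, v ≠ r → ∑ u, x₀ v u ≤ ∑ u, x₀ u v) (hvr : v ≠ r)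
    (hc : ∀ a b, c a b ≤ c a v + c v b) :
    ∃ x : V → V → ℝ, (∀ a b, 0 ≤ x a b) ∧
      (∀ S : Set V, r ∉ S → ∀ t ∈ S, t ≠ v → q t ≤ cut x S) ∧
      (∀ v, v ≠ r → ∑ u, x v u ≤ ∑ u, x u v) ∧
      (∑ a, ∑ b, c a b * x a b ≤ ∑ a, ∑ b, c a b * x₀ a b) ∧
      ∀ w, w ≠ v → x v w = 0 := by
  set K : Set (V → V → ℝ) := {x | (∀ a b, 0 ≤ x a b) ∧
      (∀ S : Set V, r ∉ S → ∀ t ∈ S, t ≠ v → q t ≤ cut x S) ∧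
      (∀ v, v ≠ r → ∑ u, x v u ≤ ∑ u, x u v) ∧
      (∑ a, ∑ b, c a b * x a b ≤ ∑ a, ∑ b, c a b * x₀ a b) ∧
      ∑ a, ∑ b, x a b ≤ ∑ a, ∑ b, x₀ a b} with hK
  have hclosed : IsClosed K := by
    simp only [hK, Set.ofPred_and, Set.ofPred_forall]
    refine IsClosed.inter ?_ (IsClosed.inter ?_ (IsClosed.inter ?_ (IsClosed.inter ?_ ?_)))
    · exact isClosed_iInter fun a => isClosed_iInter fun b =>
        isClosed_le (by fun_prop) (by fun_prop)
    · refine isClosed_iInter fun S => isClosed_iInter fun _ => isClosed_iInter fun t =>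
        isClosed_iInter fun _ => isClosed_iInter fun _ => isClosed_le (by fun_prop) ?_
      refine continuous_finsetSum _ fun a _ => continuous_finsetSum _ fun b _ => ?_
      split_ifs <;> fun_prop
    · exact isClosed_iInter fun a => isClosed_iInter fun _ =>
        isClosed_le (by fun_prop) (by fun_prop)
    · exact isClosed_le (by fun_prop) (by fun_prop)
    · exact isClosed_le (by fun_prop) (by fun_prop)
  have hcompact : IsCompact K := by
    refine (isCompact_Icc (a := (0 : V → V → ℝ))
      (b := fun _ _ => ∑ a, ∑ b, x₀ a b)).of_isClosed_subset hclosed ?_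
    rintro x ⟨hx, -, -, -, hs⟩
    refine ⟨fun a b => hx a b, fun a b => le_trans ?_ hs⟩
    exact (single_le_sum (f := fun b => x a b) (fun b _ => hx a b) (mem_univ b)).trans
      (single_le_sum (f := fun a => ∑ b, x a b) (fun a _ => sum_nonneg fun b _ => hx a b)
        (mem_univ a))
  obtain ⟨x, ⟨hx, hcut, hflow, hcost, hsum⟩, hmin⟩ := hcompact.exists_isMinOn
    ⟨x₀, hx₀, hcut₀, hflow₀, le_rfl, le_rfl⟩
    (f := fun x => ∑ a, ∑ b, x a b) (by fun_prop)
  refine ⟨x, hx, hcut, hflow, hcost, fun w hwv => ?_⟩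
  by_contra hvw
  have hvw : 0 < x v w := lt_of_le_of_ne (hx v w) (Ne.symm hvw)
  obtain ⟨u, huv, hu, htight⟩ := exists_splittable hx hcut hflow hvr hwv hvw
  have hent : ∀ᶠ ε in nhdsWithin (0 : ℝ) (Set.Ioi 0),
      ∀ a b, 0 ≤ x a b + ε * splitDir u v w a b := by
    refine Filter.eventually_all.2 fun a => Filter.eventually_all.2 fun b => ?_
    refine eventually_nonneg_add_mul ?_
    by_cases h₁ : a = u ∧ b = v
    · obtain ⟨rfl, rfl⟩ := h₁
      exact Or.inl hu
    by_cases h₂ : a = v ∧ b = w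
    · obtain ⟨rfl, rfl⟩ := h₂
      exact Or.inl hvw
    · refine Or.inr ⟨hx a b, ?_⟩
      simp only [splitDir, h₁, h₂, if_false, sub_zero]
      split_ifs <;> norm_num
  have hcuts : ∀ᶠ ε in nhdsWithin (0 : ℝ) (Set.Ioi 0), ∀ S : Set V, ∀ t : V,
      r ∉ S → t ∈ S → t ≠ v → 0 ≤ (cut x S - q t) + ε * cut (splitDir u v w) S := by
    refine Filter.eventually_all.2 fun S => Filter.eventually_all.2 fun t => ?_
    by_cases h : r ∉ S ∧ t ∈ S ∧ t ≠ v
    · obtain ⟨hr, ht, htv⟩ := h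
      have hle := hcut S hr t ht htv
      have : 0 < cut x S - q t ∨ 0 ≤ cut x S - q t ∧ 0 ≤ cut (splitDir u v w) S := by
        rcases hle.lt_or_eq with h | h
        · exact Or.inl (by linarith)
        · obtain ⟨h₁, h₂⟩ := htight S ⟨hr, t, ht, htv, h.symm⟩
          exact Or.inr ⟨by linarith, cut_splitDir_nonneg h₁ h₂⟩
      filter_upwards [eventually_nonneg_add_mul this] with ε hε _ _ _ using hε
    · exact Filter.Eventually.of_forall fun ε hr ht htv => absurd ⟨hr, ht, htv⟩ h
  obtain ⟨ε, ⟨hε₁, hε₂⟩, hε⟩ := ((hent.and hcuts).and self_mem_nhdsWithin).exists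
  have hε : 0 < ε := hε
  have hcost' := sum_mul_splitDir c u v w
  have hsum' := sum_mul_splitDir (fun _ _ => 1) u v w
  simp only [one_mul] at hsum'
  have hnew : ∑ a, ∑ b, (x a b + ε * splitDir u v w a b) = ∑ a, ∑ b, x a b - ε := by
    simp only [sum_add_distrib, ← mul_sum, hsum']
    ring
  have hmem : (fun a b => x a b + ε * splitDir u v w a b) ∈ K := by
    refine ⟨hε₁, fun S hr t ht htv => ?_, fun a ha => ?_, ?_, ?_⟩
    · rw [cut_add_smul]
      linarith [hε₂ S t hr ht htv]
    · simp only [sum_add_distrib, ← mul_sum, sum_splitDir_out u v w a]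
      linarith [hflow a ha]
    · have : ∑ a, ∑ b, c a b * (x a b + ε * splitDir u v w a b) =
          ∑ a, ∑ b, c a b * x a b + ε * (c u w - c u v - c v w) := by
        rw [← hcost']
        simp only [mul_sum, ← sum_add_distrib]
        exact sum_congr rfl fun a _ => sum_congr rfl fun b _ => by ring
      rw [this]
      nlinarith [hc u w]
    · rw [hnew]
      linarith
  have := hmin hmem
  simp only [Set.mem_ofPred_eq, hnew] at this
  linarith

end Splitting

section Arborescences

variable {V : Type*}

/-- Reachability along a finite set of arcs. -/
abbrev Reach (F : Finset (V × V)) : V → V → Prop :=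
  Relation.ReflTransGen fun a b => (a, b) ∈ F

/-- `par` is the parent function of an out-arborescence on `S` rooted at `r`. -/
def IsArborescence (r : V) (S : Finset V) (par : V → V) : Prop :=
  r ∈ S ∧ (∀ v ∈ S, v ≠ r → par v ∈ S) ∧ ∀ v ∈ S, ∃ n : ℕ, par^[n] v = r

/-- A vertex is reached by a walk of the given length. -/
inductive ReachIn (F : Finset (V × V)) (r : V) : ℕ → V → Prop
  | zero : ReachIn F r 0 r
  | succ {n : ℕ} {u v : V} : ReachIn F r n u → (u, v) ∈ F → ReachIn F r (n + 1) v

lemma ReachIn.reach {F : Finset (V × V)} {r v : V} {n : ℕ} (h : ReachIn F r n v) :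
    Reach F r v := by
  induction h with
  | zero => exact .refl
  | succ _ h ih => exact ih.tail h

lemma exists_reachIn {F : Finset (V × V)} {r v : V} (h : Reach F r v) : ∃ n, ReachIn F r n v := by
  induction h with
  | refl => exact ⟨0, .zero⟩
  | tail _ h ih =>
    obtain ⟨n, hn⟩ := ih
    exact ⟨n + 1, .succ hn h⟩

lemma exists_isArborescence [Fintype V] (F : Finset (V × V)) (r : V) :
    ∃ S par, IsArborescence r S par ∧ (∀ v, v ∈ S ↔ Reach F r v) ∧
      ∀ v ∈ S, v ≠ r → (par v, v) ∈ F := by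
  classical
  have hpar : ∀ v, ∃ u, ∀ h : Reach F r v, v ≠ r → (u, v) ∈ F ∧
      ∃ hu : Reach F r u, Nat.find (exists_reachIn hu) < Nat.find (exists_reachIn h) := by
    intro v
    by_cases h : Reach F r v ∧ v ≠ r
    · obtain ⟨h, hvr⟩ := h
      have key := Nat.find_spec (exists_reachIn h)
      generalize hn : Nat.find (exists_reachIn h) = n at key
      cases key with
      | zero => exact absurd rfl hvr
      | @succ m u _ hu huv =>
        refine ⟨u, fun _ _ => ⟨huv, hu.reach, ?_⟩⟩
        rw [hn]
        exact Nat.lt_succ_of_le (Nat.find_min' _ hu)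
    · exact ⟨r, fun h₁ h₂ => absurd ⟨h₁, h₂⟩ h⟩
  choose par hpar using hpar
  refine ⟨univ.filter (Reach F r), par, ⟨by simpa using .refl, ?_, ?_⟩, by simp, ?_⟩
  · intro v hv hvr
    obtain ⟨-, hu, -⟩ := hpar v (by simpa using hv) hvr
    simpa using hu
  · intro v hv
    have hv : Reach F r v := by simpa using hv
    induction hn : Nat.find (exists_reachIn hv) using Nat.strong_induction_on generalizing v with
    | _ n ih =>
      by_cases hvr : v = r
      · exact ⟨0, hvr⟩
      · obtain ⟨-, hu, hlt⟩ := hpar v hv hvr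
        obtain ⟨m, hm⟩ := ih _ (hn ▸ hlt) (par v) (by simpa using hu) hu rfl
        exact ⟨m + 1, hm⟩
  · intro v hv hvr
    exact (hpar v (by simpa using hv) hvr).1

variable [Fintype V]

open Classical in
/-- Some set of arcs has prize-collecting cost at most `B`. -/
def HasCost (r : V) (c : V → V → ℝ) (π : V → ℝ) (B : ℝ) : Prop :=
  ∃ F : Finset (V × V), ∑ e ∈ F, c e.1 e.2 + (∑ v, if Reach F r v then 0 else π v) ≤ B

lemma HasCost.exists_arborescence [DecidableEq V] {r : V} {c : V → V → ℝ} {π : V → ℝ} {B : ℝ}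
    (hc : ∀ a b, 0 ≤ c a b) (h : HasCost r c π B) :
    ∃ S par, IsArborescence r S par ∧
      ∑ v ∈ S.erase r, c (par v) v + ∑ v ∈ Sᶜ, π v ≤ B := by
  classical
  obtain ⟨F, hF⟩ := h
  obtain ⟨S, par, hT, hS, hpar⟩ := exists_isArborescence F r
  refine ⟨S, par, hT, le_trans (add_le_add ?_ (le_of_eq ?_)) hF⟩
  · have hinj : Set.InjOn (fun v => (par v, v)) (S.erase r : Finset V) :=
      fun a _ b _ hab => congrArg Prod.snd hab
    rw [← sum_image (g := fun v => (par v, v)) (f := fun e : V × V => c e.1 e.2) hinj]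
    refine sum_le_sum_of_subset_of_nonneg ?_ fun e _ _ => hc _ _
    intro e he
    obtain ⟨v, hv, rfl⟩ := mem_image.1 he
    exact hpar v (mem_of_mem_erase hv) (ne_of_mem_erase hv)
  · have : Sᶜ = univ.filter fun v => ¬ Reach F r v := by ext v; simp [hS]
    rw [this, sum_filter]
    exact sum_congr rfl fun v _ => by split_ifs <;> simp_all

lemma IsArborescence.hasCost [DecidableEq V] {r : V} {c : V → V → ℝ} {π : V → ℝ} {B : ℝ}
    (hπ : ∀ v, 0 ≤ π v) {S : Finset V} {par : V → V} (hT : IsArborescence r S par)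
    (hB : ∑ v ∈ S.erase r, c (par v) v + ∑ v ∈ Sᶜ, π v ≤ B) : HasCost r c π B := by
  classical
  obtain ⟨hr, hpar, hit⟩ := hT
  refine ⟨(S.erase r).image fun v => (par v, v), le_trans (add_le_add (le_of_eq ?_) ?_) hB⟩
  · exact sum_image fun a _ b _ hab => congrArg Prod.snd hab
  · have hreach : ∀ n, ∀ v ∈ S, par^[n] v = r →
        Reach ((S.erase r).image fun v => (par v, v)) r v := by
      intro n
      induction n with
      | zero => rintro v - rfl; exact .refl
      | succ n ih =>
        intro v hv hn
        by_cases hvr : v = r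
        · subst hvr; exact .refl
        · exact (ih (par v) (hpar v hv hvr) hn).tail
            (mem_image.2 ⟨v, mem_erase.2 ⟨hvr, hv⟩, rfl⟩)
    have : Sᶜ = univ.filter fun v => v ∉ S := by ext v; simp
    rw [this, sum_filter]
    refine sum_le_sum fun v _ => ?_
    by_cases hv : v ∈ S
    · obtain ⟨n, hn⟩ := hit v hv
      simp [hv, hreach n v hv hn]
    · rw [if_pos hv]
      split_ifs
      exacts [hπ v, le_rfl]

lemma sum_biUnion_le_sum {ι α : Type*} [DecidableEq α] [DecidableEq ι] {f : α → ℝ}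
    (hf : ∀ a, 0 ≤ f a) (s : Finset ι) (t : ι → Finset α) :
    ∑ a ∈ s.biUnion t, f a ≤ ∑ i ∈ s, ∑ a ∈ t i, f a := by
  induction s using Finset.induction_on with
  | empty => simp
  | insert i s hi ih =>
    rw [biUnion_insert, sum_insert hi]
    have := sum_union_inter (s₁ := t i) (s₂ := s.biUnion t) (f := f)
    have := sum_nonneg (s := t i ∩ s.biUnion t) fun a _ => hf a
    linarith

open Classical in
/-- Transfer of an arc set from `W` to `V`: each arc is replaced by the arcs `g e`, and the
zero-cost arcs `Z` are added. -/
lemma HasCost.lift [DecidableEq V] {W : Type*} [Fintype W] {r : V} {c : V → V → ℝ} {π : V → ℝ}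
    {B : ℝ} {r' : W} {c' : W → W → ℝ} {π' : W → ℝ} (hc : ∀ a b, 0 ≤ c a b) (Z : Finset (V × V))
    (hZ : ∀ e ∈ Z, c e.1 e.2 = 0) (g : W × W → Finset (V × V))
    (hg : ∀ e, ∑ e' ∈ g e, c e'.1 e'.2 ≤ c' e.1 e.2)
    (hpen : ∀ F, (∑ v, if Reach (Z ∪ F.biUnion g) r v then 0 else π v) ≤
      ∑ a, if Reach F r' a then 0 else π' a)
    (h : HasCost r' c' π' B) : HasCost r c π B := by
  obtain ⟨F, hF⟩ := h
  refine ⟨Z ∪ F.biUnion g, le_trans (add_le_add ?_ (hpen F)) hF⟩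
  have h₁ := sum_union_inter (s₁ := Z) (s₂ := F.biUnion g) (f := fun e : V × V => c e.1 e.2)
  have h₂ := sum_nonneg (s := Z ∩ F.biUnion g) fun (e : V × V) _ => hc e.1 e.2
  have h₃ := sum_biUnion_le_sum (f := fun e : V × V => c e.1 e.2) (fun e => hc _ _) F g
  have h₄ := sum_le_sum (s := F) fun e _ => hg e
  have h₅ := sum_eq_zero hZ
  linarith

end Arborescences

section Feasibility

variable {V : Type*} [Fintype V]

/-- Feasibility for the prize-collecting walks LP on the complete digraph. -/
structure Feasible (r : V) (x : V → V → ℝ) (p : V → ℝ) : Prop where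
  nonneg : ∀ a b, 0 ≤ x a b
  penalty_nonneg : ∀ v, 0 ≤ p v
  one_le_cut_add : ∀ S : Set V, r ∉ S → ∀ v ∈ S, 1 ≤ cut x S + p v
  preflow : ∀ v, v ≠ r → ∑ u, x v u ≤ ∑ u, x u v

/-- The objective value of the prize-collecting walks LP. -/
def objective (c : V → V → ℝ) (π : V → ℝ) (x : V → V → ℝ) (p : V → ℝ) : ℝ :=
  ∑ a, ∑ b, c a b * x a b + ∑ v, π v * p v

/-- Eliminating a vertex without penalty by splitting off its arcs. -/
lemma Feasible.hasCost_of_split [DecidableEq V] {r v : V} {c : V → V → ℝ} {π : V → ℝ}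
    {x : V → V → ℝ} {p : V → ℝ} (h : Feasible r x p) (hc : ∀ a b, 0 ≤ c a b) (hπ : ∀ v, 0 ≤ π v)
    (hvr : v ≠ r) (hπv : π v = 0)
    (ih : ∀ (c' : {u // u ≠ v} → {u // u ≠ v} → ℝ) (x' : {u // u ≠ v} → {u // u ≠ v} → ℝ),
      (∀ a b, 0 ≤ c' a b) → Feasible ⟨r, hvr.symm⟩ x' (fun a => p a) →
      HasCost ⟨r, hvr.symm⟩ c' (fun a => π a) (objective c' (fun a => π a) x' (fun a => p a))) :
    HasCost r c π (objective c π x p) := by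
  classical
  set c' : V → V → ℝ := fun a b => min (c a b) (c a v + c v b) with hc'
  have htri : ∀ a b, c' a b ≤ c' a v + c' v b := by
    intro a b
    have h₁ : c' a v = c a v := min_eq_left (by linarith [hc v v])
    have h₂ : c' v b = c v b := min_eq_left (by linarith [hc v v])
    rw [h₁, h₂]
    exact min_le_right _ _
  obtain ⟨y, hy, hcut, hflow, hcost, hout⟩ := exists_split_off (q := fun t => 1 - p t) h.nonneg
    (fun S hr t ht _ => by linarith [h.one_le_cut_add S hr t ht]) h.preflow hvr htri
  have hc'₀ : ∀ a b, 0 ≤ c' a b := fun a b =>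
    le_min (hc a b) (add_nonneg (hc a v) (hc v b))
  have hfeas : Feasible (⟨r, hvr.symm⟩ : {u // u ≠ v}) (fun a b => y a b) (fun a => p a) := by
    refine ⟨fun a b => hy a b, fun a => h.penalty_nonneg a, fun S hr t ht => ?_, fun a ha => ?_⟩
    · have hS : v ∉ Set.image Subtype.val S := by rintro ⟨a, -, ha⟩; exact a.2 ha
      have h₁ := hcut (Set.image Subtype.val S) (by rintro ⟨a, ha, rfl⟩; exact hr ha) t ⟨t, ht, rfl⟩ t.2
      suffices cut y (Set.image Subtype.val S) = cut (fun a b : {u // u ≠ v} => y a b) S by linarith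
      have hzero : ∀ b, (if v ∉ Set.image Subtype.val S ∧ b ∈ Set.image Subtype.val S
          then y v b else 0) = 0 := by
        intro b
        split_ifs with hb
        · exact hout b fun h => hS (h ▸ hb.2)
        · rfl
      rw [cut, cut, Fintype.sum_eq_add_sum_subtype_ne _ v, sum_eq_zero fun b _ => hzero b, zero_add]
      refine sum_congr rfl fun a _ => ?_
      rw [Fintype.sum_eq_add_sum_subtype_ne _ v, if_neg (fun h => hS h.2), zero_add]
      refine sum_congr rfl fun b _ => ?_
      simp only [Subtype.val_injective.mem_set_image]
    · have h₁ := hflow a fun h => ha (Subtype.ext h)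
      rw [Fintype.sum_eq_add_sum_subtype_ne _ v, Fintype.sum_eq_add_sum_subtype_ne _ v,
        hout a a.2] at h₁
      linarith [hy a v]
  have hobj : objective (fun a b : {u // u ≠ v} => c' a b) (fun a => π a) (fun a b => y a b)
      (fun a => p a) ≤ objective c π x p := by
    have h₁ : ∑ a, ∑ b, c' a b * x a b ≤ ∑ a, ∑ b, c a b * x a b :=
      sum_le_sum fun a _ => sum_le_sum fun b _ =>
        mul_le_mul_of_nonneg_right (min_le_left _ _) (h.nonneg a b)
    have h₂ : ∑ a : {u // u ≠ v}, ∑ b : {u // u ≠ v}, c' a b * y a b ≤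
        ∑ a, ∑ b, c' a b * y a b := by
      rw [Fintype.sum_eq_add_sum_subtype_ne (fun a => ∑ b, c' a b * y a b) v]
      refine le_add_of_nonneg_of_le (sum_nonneg fun b _ => mul_nonneg (hc'₀ _ _) (hy _ _))
        (sum_le_sum fun a _ => ?_)
      rw [Fintype.sum_eq_add_sum_subtype_ne (fun b => c' a b * y a b) v]
      exact le_add_of_nonneg_left (mul_nonneg (hc'₀ _ _) (hy _ _))
    have h₃ : ∑ a : {u // u ≠ v}, π a * p a = ∑ a, π a * p a := by
      rw [Fintype.sum_eq_add_sum_subtype_ne (fun a => π a * p a) v, hπv, zero_mul, zero_add]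
    simp only [objective]
    linarith
  obtain ⟨F, hF⟩ := ih (fun a b => c' a b) (fun a b => y a b) (fun a b => hc'₀ a b) hfeas
  set g : {u // u ≠ v} × {u // u ≠ v} → Finset (V × V) := fun e =>
    if c e.1 e.2 ≤ c e.1 v + c v e.2 then {(e.1.1, e.2.1)} else {(e.1.1, v), (v, e.2.1)} with hg
  refine HasCost.lift (r' := (⟨r, hvr.symm⟩ : {u // u ≠ v})) (c' := fun a b => c' a b)
    (π' := fun a => π a) hc ∅ (by simp) g ?_ ?_ ⟨F, hF.trans hobj⟩
  · rintro ⟨a, b⟩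
    simp only [hg]
    split_ifs with hab
    · rw [sum_singleton]
      exact le_min le_rfl hab
    · rw [sum_pair fun h => a.2 (congrArg Prod.fst h)]
      exact le_min (not_le.1 hab).le le_rfl
  · intro F
    rw [Fintype.sum_eq_add_sum_subtype_ne _ v, hπv, ite_self, zero_add, empty_union]
    have hreach : ∀ a, Reach F ⟨r, hvr.symm⟩ a → Reach (F.biUnion g) r a := by
      intro a ha
      induction ha with
      | refl => exact .refl
      | @tail s t _ hst ih =>
        have hsub : g (s, t) ⊆ F.biUnion g := subset_biUnion_of_mem g hst
        by_cases hle : c s t ≤ c s v + c v t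
        · exact ih.tail (hsub (by simp [hg, hle]))
        · have hgst : g (s, t) = {(s.1, v), (v, t.1)} := if_neg hle
          exact (ih.tail (hsub (by simp [hgst]))).tail (b := v) (hsub (by simp [hgst]))
    refine sum_le_sum fun a _ => ?_
    by_cases ha : Reach F ⟨r, hvr.symm⟩ a
    · rw [if_pos ha, if_pos (hreach a ha)]
    · rw [if_neg ha]
      split_ifs
      exacts [hπ a, le_rfl]

open Classical in
/-- The weights induced on the image of a map by summing over its fibers. -/
noncomputable def pushforward {W : Type*} (f : V → W) (x : V → V → ℝ) (a b : W) : ℝ :=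
  ∑ u, ∑ w, if f u = a ∧ f w = b then x u w else 0

lemma sum_mul_pushforward {W : Type*} [Fintype W] (f : V → W) (x : V → V → ℝ)
    (k : W → W → ℝ) :
    ∑ a, ∑ b, k a b * pushforward f x a b = ∑ u, ∑ w, k (f u) (f w) * x u w := by
  classical
  have h₁ : ∀ a b, k a b * pushforward f x a b =
      ∑ u, ∑ w, if f u = a ∧ f w = b then k a b * x u w else 0 := by
    intro a b
    simp only [pushforward, mul_sum, mul_ite, mul_zero]
  simp only [h₁]
  rw [sum_congr rfl fun a _ => sum_comm, sum_comm]
  refine sum_congr rfl fun u _ => ?_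
  rw [sum_congr rfl fun a _ => sum_comm, sum_comm]
  refine sum_congr rfl fun w _ => ?_
  simp [ite_and]

/-- Contracting the fibers of a map, each of which is strongly connected by zero-cost arcs. -/
lemma Feasible.hasCost_of_contract {W : Type*} [Fintype W] {r : V} {c : V → V → ℝ} {π : V → ℝ}
    {x : V → V → ℝ} {p : V → ℝ} (h : Feasible r x p) (hc : ∀ a b, 0 ≤ c a b)
    (hπ : ∀ v, 0 ≤ π v) {f : V → W} (hf : Function.Surjective f) (Z : Finset (V × V))
    (hZ : ∀ e ∈ Z, c e.1 e.2 = 0) (hfZ : ∀ u w, f u = f w → Reach Z u w)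
    (ih : ∀ (c' : W → W → ℝ) (π' : W → ℝ) (x' : W → W → ℝ) (p' : W → ℝ),
      (∀ a b, 0 ≤ c' a b) → (∀ a, 0 ≤ π' a) → Feasible (f r) x' p' →
      HasCost (f r) c' π' (objective c' π' x' p')) :
    HasCost r c π (objective c π x p) := by
  classical
  have hg : ∀ e : W × W, ∃ g : V × V, (f g.1 = e.1 ∧ f g.2 = e.2) ∧
      ∀ u w, f u = e.1 → f w = e.2 → c g.1 g.2 ≤ c u w := by
    rintro ⟨a, b⟩
    obtain ⟨u, rfl⟩ := hf a
    obtain ⟨w, rfl⟩ := hf b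
    obtain ⟨g, hg, hmin⟩ := exists_min_image
      (univ.filter fun g : V × V => f g.1 = f u ∧ f g.2 = f w) (fun g => c g.1 g.2)
      ⟨(u, w), by simp⟩
    exact ⟨g, by simpa using hg, fun u' w' hu hw => hmin (u', w') (by simp [hu, hw])⟩
  choose g hgf hgmin using hg
  have hm : ∀ a : W, ∃ m : V, f m = a ∧ ∀ u, f u = a → p m ≤ p u := by
    intro a
    obtain ⟨u, rfl⟩ := hf a
    obtain ⟨m, hm, hmin⟩ := exists_min_image (univ.filter fun m => f m = f u) p ⟨u, by simp⟩
    exact ⟨m, by simpa using hm, fun u' hu => hmin u' (by simp [hu])⟩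
  choose m hmf hmmin using hm
  have hpush : ∀ k : W → ℝ, ∑ a, k a * (∑ u, if f u = a then π u else 0) =
      ∑ u, k (f u) * π u := by
    intro k
    simp only [mul_sum, mul_ite, mul_zero]
    rw [sum_comm]
    simp
  have hfeas : Feasible (f r) (pushforward f x) (fun a => p (m a)) := by
    refine ⟨fun a b => ?_, fun a => h.penalty_nonneg _, fun S hr a ha => ?_, fun a ha => ?_⟩
    · refine sum_nonneg fun u _ => sum_nonneg fun w _ => ?_
      split_ifs
      exacts [h.nonneg u w, le_rfl]
    · have h₁ := h.one_le_cut_add (f ⁻¹' S) hr (m a) (by rwa [Set.mem_preimage, hmf])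
      have h₂ := sum_mul_pushforward f x fun a b => if a ∉ S ∧ b ∈ S then 1 else 0
      simp only [ite_mul, one_mul, zero_mul] at h₂
      rw [cut, h₂]
      exact h₁
    · have h₁ := sum_mul_pushforward f x fun s _ => if s = a then 1 else 0
      have h₂ := sum_mul_pushforward f x fun _ t => if t = a then 1 else 0
      rw [sum_comm] at h₁
      simp only [ite_mul, one_mul, zero_mul, sum_ite_eq', mem_univ, if_true] at h₁ h₂
      rw [h₁, h₂]
      exact preflow_set h.preflow (I := f ⁻¹' {a}) fun h => ha (Set.mem_singleton_iff.1 h).symm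
  obtain ⟨F, hF⟩ := ih (fun a b => c (g (a, b)).1 (g (a, b)).2)
    (fun a => ∑ u, if f u = a then π u else 0) _ _ (fun a b => hc _ _)
    (fun a => sum_nonneg fun u _ => by split_ifs; exacts [hπ u, le_rfl]) hfeas
  have hobj : objective (fun a b => c (g (a, b)).1 (g (a, b)).2)
      (fun a => ∑ u, if f u = a then π u else 0) (pushforward f x) (fun a => p (m a)) ≤
      objective c π x p := by
    refine add_le_add ?_ ?_
    · rw [sum_mul_pushforward f x fun a b => c (g (a, b)).1 (g (a, b)).2]
      exact sum_le_sum fun u _ => sum_le_sum fun w _ =>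
        mul_le_mul_of_nonneg_right (hgmin (f u, f w) u w rfl rfl) (h.nonneg u w)
    · simp only [mul_comm _ (p _)]
      rw [hpush fun a => p (m a)]
      exact sum_le_sum fun u _ => mul_le_mul_of_nonneg_right (hmmin (f u) u rfl) (hπ u)
  refine HasCost.lift (c' := fun a b => c (g (a, b)).1 (g (a, b)).2) hc Z hZ (fun e => {g e})
    (fun e => by simp) ?_ ⟨F, hF.trans hobj⟩
  intro F
  have hreach : ∀ a, Reach F (f r) a → ∀ u, f u = a →
      Reach (Z ∪ F.biUnion fun e => {g e}) r u := by
    have hmono : ∀ {s t}, Reach Z s t → Reach (Z ∪ F.biUnion fun e => {g e}) s t :=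
      fun hst => Relation.ReflTransGen.mono (fun _ _ hz => mem_union_left _ hz) _ _ hst
    intro a ha
    induction ha with
    | refl => exact fun u hu => hmono (hfZ r u hu.symm)
    | @tail s t _ hst ih =>
      intro u hu
      refine ((ih (g (s, t)).1 (hgf (s, t)).1).tail (c := (g (s, t)).2) ?_).trans
        (hmono (hfZ _ _ ((hgf (s, t)).2.trans hu.symm)))
      exact mem_union_right _ (mem_biUnion.2 ⟨(s, t), hst, by simp⟩)
  have h₁ := hpush fun a => if Reach F (f r) a then 0 else 1
  simp only [ite_mul, one_mul, zero_mul] at h₁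
  rw [h₁]
  refine sum_le_sum fun u _ => ?_
  by_cases hu : Reach F (f r) (f u)
  · rw [if_pos hu, if_pos (hreach _ hu u rfl)]
  · rw [if_neg hu]
    split_ifs
    exacts [hπ u, le_rfl]

/-- Lowering the cost of the arcs entering each vertex together with the penalty of that
vertex. -/
lemma Feasible.hasCost_of_reduce {r : V} {c : V → V → ℝ} {π : V → ℝ} {x : V → V → ℝ} {p : V → ℝ}
    (h : Feasible r x p) (hπ : ∀ v, 0 ≤ π v) {c' : V → V → ℝ} {π' y : V → ℝ}
    (hc' : ∀ a b, 0 ≤ c' a b) (hy : ∀ v, 0 ≤ y v) (hyr : y r = 0)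
    (hcy : ∀ a b, a ≠ b → c' a b = c a b - y b) (hcd : ∀ a, c' a a = c a a)
    (hπy : ∀ v, π' v = π v - y v) (hred : HasCost r c' π' (objective c' π' x p)) :
    HasCost r c π (objective c π x p) := by
  classical
  obtain ⟨S, par, hT, hB⟩ := hred.exists_arborescence hc'
  refine hT.hasCost hπ ?_
  have h₁ : ∑ v ∈ S.erase r, c (par v) v ≤ ∑ v ∈ S.erase r, c' (par v) v + ∑ v ∈ S, y v := by
    rw [← sum_erase S hyr, ← sum_add_distrib]
    refine sum_le_sum fun v _ => ?_
    by_cases hv : par v = v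
    · rw [hv, hcd]
      linarith [hy v]
    · rw [hcy _ _ hv]
      linarith
  have h₂ : ∑ v ∈ Sᶜ, π v = ∑ v ∈ Sᶜ, π' v + ∑ v ∈ Sᶜ, y v := by
    rw [← sum_add_distrib]
    exact sum_congr rfl fun v _ => by rw [hπy]; ring
  have h₃ : ∑ v, y v ≤ ∑ v, y v * (cut x {v} + p v) := by
    refine sum_le_sum fun v _ => ?_
    by_cases hv : v = r
    · simp [hv, hyr]
    · exact le_mul_of_one_le_right (hy v)
        (h.one_le_cut_add {v} (fun hr => hv (Set.mem_singleton_iff.1 hr).symm) v rfl)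
  have h₄ : ∑ v, y v * (cut x {v} + p v) = ∑ a, ∑ b, (c a b - c' a b) * x a b +
      ∑ v, y v * p v := by
    simp only [mul_add, sum_add_distrib]
    congr 1
    rw [sum_comm]
    refine sum_congr rfl fun v _ => ?_
    rw [cut, mul_sum]
    refine sum_congr rfl fun a _ => ?_
    by_cases ha : a = v
    · simp [ha, hcd]
    · simp [ha, hcy a v ha]
  have h₅ : objective c π x p = objective c' π' x p +
      (∑ a, ∑ b, (c a b - c' a b) * x a b + ∑ v, y v * p v) := by
    simp only [objective, hπy, sub_mul, sum_sub_distrib]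
    ring
  linarith [sum_add_sum_compl S y]

/-- If every vertex other than `r` has an entering arc in `Z` and `Z` has no cycles, then
everything is reachable from `r`. -/
lemma reach_of_antisymm {r : V} {Z : Finset (V × V)}
    (hin : ∀ v, v ≠ r → ∃ u, u ≠ v ∧ (u, v) ∈ Z)
    (hanti : ∀ u w, Reach Z u w → Reach Z w u → u = w) (v : V) : Reach Z r v := by
  classical
  induction hn : #(univ.filter fun u => Reach Z u v) using Nat.strong_induction_on
    generalizing v with
  | _ n ih =>
    by_cases hv : v = r
    · rw [hv]
    · obtain ⟨u, huv, hu⟩ := hin v hv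
      refine (ih _ ?_ u rfl).tail hu
      rw [← hn]
      refine card_lt_card (Finset.ssubset_iff_subset_ne.2 ⟨fun s hs => ?_, fun heq => huv ?_⟩)
      · simp only [mem_filter, mem_univ, true_and] at hs ⊢
        exact hs.tail hu
      · have hmem : v ∈ univ.filter fun s => Reach Z s u := by
          rw [heq]
          simpa using .refl
        exact hanti u v (.single hu) (by simpa using hmem)

end Feasibility

/-- Every feasible LP solution is matched by an arc set of no larger prize-collecting cost. -/
theorem Feasible.hasCost {V : Type u} [Fintype V] {r : V} {c : V → V → ℝ} {π : V → ℝ}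
    {x : V → V → ℝ} {p : V → ℝ} (h : Feasible r x p) (hc : ∀ a b, 0 ≤ c a b)
    (hπ : ∀ v, 0 ≤ π v) : HasCost r c π (objective c π x p) := by
  classical
  induction hn : Fintype.card V using Nat.strong_induction_on generalizing V with
  | _ n ih =>
    have hy : ∀ v, ∃ y : ℝ, 0 ≤ y ∧ (v = r → y = 0) ∧ y ≤ π v ∧ (∀ u, u ≠ v → y ≤ c u v) ∧
        (v ≠ r → y = π v ∨ ∃ u, u ≠ v ∧ y = c u v) := by
      intro v
      by_cases hv : v = r
      · exact ⟨0, le_rfl, fun _ => rfl, hπ v, fun u _ => hc u v, fun h => absurd hv h⟩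
      · obtain ⟨u, hu, hmin⟩ := exists_min_image (univ.erase v) (fun u => c u v)
          ⟨r, by simp [Ne.symm hv]⟩
        refine ⟨min (π v) (c u v), le_min (hπ v) (hc u v), fun h => absurd h hv,
          min_le_left _ _, fun s hs => (min_le_right _ _).trans (hmin s (by simp [hs])),
          fun _ => ?_⟩
        rcases min_choice (π v) (c u v) with h | h
        · exact Or.inl h
        · exact Or.inr ⟨u, ne_of_mem_erase hu, h⟩
    choose y hy₀ hyr hyπ hyc hytight using hy
    set c' : V → V → ℝ := fun a b => if a = b then c a b else c a b - y b with hc'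
    have hc'₀ : ∀ a b, 0 ≤ c' a b := by
      intro a b
      simp only [hc']
      split_ifs with hab
      · exact hc a b
      · linarith [hyc b a hab]
    have hπ'₀ : ∀ v, 0 ≤ π v - y v := fun v => by linarith [hyπ v]
    refine h.hasCost_of_reduce hπ (c' := c') (π' := fun v => π v - y v) hc'₀ hy₀ (hyr r rfl)
      (fun a b hab => by simp [hc', hab]) (fun a => by simp [hc']) (fun _ => rfl) ?_
    by_cases hzero : ∃ v, v ≠ r ∧ π v - y v = 0
    · obtain ⟨v, hvr, hv⟩ := hzero
      refine h.hasCost_of_split hc'₀ hπ'₀ hvr hv fun c'' x'' hc'' hfeas => ?_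
      exact ih _ (hn ▸ Fintype.card_subtype_lt (x := v) (by simp)) hfeas hc''
        (fun a => hπ'₀ a) rfl
    set Z : Finset (V × V) := univ.filter fun e => c' e.1 e.2 = 0 with hZdef
    have hZ : ∀ e ∈ Z, c' e.1 e.2 = 0 := fun e he => (mem_filter.1 he).2
    by_cases hanti : ∀ u w, Reach Z u w → Reach Z w u → u = w
    · have hin : ∀ v, v ≠ r → ∃ u, u ≠ v ∧ (u, v) ∈ Z := by
        intro v hv
        rcases hytight v hv with h | ⟨u, huv, h⟩
        · exact absurd ⟨v, hv, by linarith⟩ hzero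
        · exact ⟨u, huv, mem_filter.2 ⟨mem_univ _, by simp [hc', huv, h]⟩⟩
      refine ⟨Z, ?_⟩
      rw [sum_eq_zero hZ, sum_eq_zero fun v _ => if_pos (reach_of_antisymm hin hanti v), add_zero]
      exact add_nonneg
        (sum_nonneg fun a _ => sum_nonneg fun b _ => mul_nonneg (hc'₀ a b) (h.nonneg a b))
        (sum_nonneg fun v _ => mul_nonneg (hπ'₀ v) (h.penalty_nonneg v))
    · push Not at hanti
      obtain ⟨u, w, huw, hwu, hne⟩ := hanti
      let s : Setoid V := ⟨fun u w => Reach Z u w ∧ Reach Z w u,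
        fun _ => ⟨.refl, .refl⟩, fun h => ⟨h.2, h.1⟩,
        fun h₁ h₂ => ⟨h₁.1.trans h₂.1, h₂.2.trans h₁.2⟩⟩
      have : Fintype (Quotient s) := Fintype.ofFinite _
      refine h.hasCost_of_contract hc'₀ hπ'₀ (f := Quotient.mk s) Quotient.mk_surjective Z hZ
        (fun a b hab => (Quotient.exact hab).1) fun c'' π'' x'' p'' hc'' hπ'' hfeas => ?_
      refine ih _ ?_ hfeas hc'' hπ'' rfl
      rw [← hn]
      exact Fintype.card_lt_of_surjective_not_injective _ Quotient.mk_surjective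
        fun hinj => hne (hinj (Quotient.sound ⟨huw, hwu⟩))

/-- Every LP solution supported on `A` is matched by an arborescence with arcs in `A`. -/
theorem exists_arborescence_of_LPfeas {V : Type*} [Fintype V] [DecidableEq V]
    {A : Finset (V × V)} {r : V} {c : V → V → ℝ} {π : V → ℝ} {x : V → V → ℝ} {p : V → ℝ}
    (hc : ∀ u w, 0 ≤ c u w) (hπ : ∀ u, 0 ≤ π u) (h : LPfeas A r x p) :
    ∃ S par, IsArborescence r S par ∧ (∀ v ∈ S, v ≠ r → (par v, v) ∈ A) ∧
      ∑ v ∈ S.erase r, c (par v) v + ∑ v ∈ Sᶜ, π v ≤ objective c π x p := by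
  classical
  obtain ⟨hx, hp, hA, hcut, hflow⟩ := h
  have hfeas : Feasible r x p := by
    refine ⟨hx, hp, fun S hr v hv => ?_, hflow⟩
    have h₁ := hcut S.toFinset (by simpa using hr) v (by simpa using hv)
    suffices cut x S = ∑ u ∈ S.toFinsetᶜ, ∑ w ∈ S.toFinset, x u w by rwa [this]
    have h₂ : S.toFinsetᶜ = univ.filter (· ∉ S) := by ext; simp
    have h₃ : S.toFinset = univ.filter (· ∈ S) := by ext; simp
    rw [cut, h₂, h₃, sum_filter]
    refine sum_congr rfl fun a _ => ?_
    by_cases ha : a ∈ S <;> simp [ha, sum_filter]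
  have hobj₀ : 0 ≤ objective c π x p := add_nonneg
    (sum_nonneg fun a _ => sum_nonneg fun b _ => mul_nonneg (hc a b) (hx a b))
    (sum_nonneg fun v _ => mul_nonneg (hπ v) (hp v))
  -- Arcs outside `A` get a prohibitive cost.
  set c' : V → V → ℝ := fun a b => if (a, b) ∈ A then c a b else objective c π x p + 1 with hc'
  have hc'₀ : ∀ a b, 0 ≤ c' a b := by
    intro a b
    simp only [hc']
    split_ifs
    exacts [hc a b, by linarith]
  have hobj : objective c' π x p = objective c π x p := by
    simp only [objective]
    congr 1
    refine sum_congr rfl fun a _ => sum_congr rfl fun b _ => ?_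
    by_cases hab : (a, b) ∈ A
    · simp [hc', hab]
    · simp [hA a b hab]
  obtain ⟨S, par, hT, hB⟩ := (hfeas.hasCost hc'₀ hπ).exists_arborescence hc'₀
  rw [hobj] at hB
  have hmem : ∀ v ∈ S.erase r, (par v, v) ∈ A := by
    intro v hv
    by_contra hvA
    have h₁ := single_le_sum (f := fun v => c' (par v) v) (fun v _ => hc'₀ _ _) hv
    have h₂ := sum_nonneg (s := Sᶜ) fun v _ => hπ v
    simp only [hc', hvA, if_false] at h₁ hB
    linarith
  refine ⟨S, par, hT, fun v hv hvr => hmem v (mem_erase.2 ⟨hvr, hv⟩), ?_⟩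
  rwa [sum_congr rfl fun v hv => show c (par v) v = c' (par v) v by simp [hc', hmem v hv]]

end PrizeCollecting

/-- The minimum prize-collecting cost over out-arborescences rooted
at `r` (an arborescence is given by its vertex set `S` and parent function `par`) is at
most the optimum value of the prize-collecting walks LP. -/
theorem arborescence_le_lpOpt
    {V : Type*} [Fintype V] [DecidableEq V]
    (A : Finset (V × V)) (r : V) (c : V → V → ℝ) (π : V → ℝ)
    (hc : ∀ u w, 0 ≤ c u w) (hπ : ∀ u, 0 ≤ π u) :
    ∃ (S : Finset V) (par : V → V),
      r ∈ S ∧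
      (∀ v ∈ S, v ≠ r → (par v, v) ∈ A ∧ par v ∈ S) ∧
      (∀ v ∈ S, ∃ n : ℕ, par^[n] v = r) ∧
      (∑ v ∈ S.erase r, c (par v) v) + ∑ v ∈ Sᶜ, π v ≤ lpOpt A c π r := by
  classical
  set cost : Finset V × (V → V) → ℝ := fun T =>
    ∑ v ∈ T.1.erase r, c (T.2 v) v + ∑ v ∈ T.1ᶜ, π v
  obtain ⟨⟨S, par⟩, ⟨hT, hA⟩, hmin⟩ := Set.exists_min_image
    {T : Finset V × (V → V) | PrizeCollecting.IsArborescence r T.1 T.2 ∧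
      ∀ v ∈ T.1, v ≠ r → (T.2 v, v) ∈ A} cost (Set.toFinite _)
    ⟨({r}, id), ⟨by simp, by simp, fun v hv => ⟨0, by simpa using hv⟩⟩, by simp⟩
  refine ⟨S, par, hT.1, fun v hv hvr => ⟨hA v hv hvr, hT.2.1 v hv hvr⟩, hT.2.2, le_csInf ?_ ?_⟩
  · refine ⟨_, fun _ _ => 0, fun _ => 1, ⟨?_, ?_, ?_, ?_, ?_⟩, rfl⟩ <;> simp
  · rintro z ⟨x, p, hxp, rfl⟩
    obtain ⟨S', par', hT', hA', hle⟩ :=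
      PrizeCollecting.exists_arborescence_of_LPfeas hc hπ hxp
    exact (hmin (S', par') ⟨hT', hA'⟩).trans hle
end
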